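/- Let N ≥ 2 be an integer, let k be a nonnegative integer, let Ω be an open subset of ℝ^N, and let u : Ω → ℝ be k times continuously differentiable. Then for every x ∈ Ω, |∇_N^k u(x)|² = Σ_{j=0}^{k} C(k, j) · |∇_{N−1}^{j} (∂_N^{k−j} u)(x)|², where ∂_N denotes the partial derivative with respect to the last coordinate and ∇_{N−1}^{j} involves only partial derivatives with respect to the first N−1 coordinates, i.e. |∇_{N−1}^{j} w(x)|² = Σ_{i' ∈ {1,…,N−1}^{j}} (∂_{i'_1}⋯∂_{i'_j} w(x))². -/

import Mathlib

open scoped BigOperators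

/-- The partial derivative `∂ᵢ` of a real-valued function on `ℝ^N`. -/
noncomputable def pd {N : ℕ} (i : Fin N) (u : EuclideanSpace ℝ (Fin N) → ℝ) :
    EuclideanSpace ℝ (Fin N) → ℝ :=
  fun x => fderiv ℝ u x (EuclideanSpace.single i 1)

/-- Iterated partial derivative `D_i = ∂_{i₁} ∂_{i₂} ⋯ ∂_{i_k}` for a list of indices. -/
noncomputable def pdIter {N : ℕ} (l : List (Fin N)) (u : EuclideanSpace ℝ (Fin N) → ℝ) :
    EuclideanSpace ℝ (Fin N) → ℝ :=
  l.foldr pd u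

/-- `|∇_N^k u(x)|² = Σ_{i ∈ {1,…,N}^k} (D_i u(x))²`. -/
noncomputable def gradSq (N k : ℕ) (u : EuclideanSpace ℝ (Fin N) → ℝ)
    (x : EuclideanSpace ℝ (Fin N)) : ℝ :=
  ∑ i : Fin k → Fin N, (pdIter (List.ofFn i) u x) ^ 2

/-- The falling factorial `(ν)_k = ν(ν−1)⋯(ν−k+1)`. -/
noncomputable def ffac (ν : ℝ) (k : ℕ) : ℝ := ∏ j ∈ Finset.range k, (ν - j)

/-- The generalized binomial coefficient `C(ν,k) = (ν)_k / k!`. -/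
noncomputable def gchoose (ν : ℝ) (k : ℕ) : ℝ := ffac ν k / (Nat.factorial k)

theorem pd_contDiffOn {N : ℕ} {Ω : Set (EuclideanSpace ℝ (Fin N))} (hΩ : IsOpen Ω) (i : Fin N)
    {u : EuclideanSpace ℝ (Fin N) → ℝ} {m : ℕ} (hu : ContDiffOn ℝ ((m + 1 : ℕ)) u Ω) :
    ContDiffOn ℝ m (pd i u) Ω := by
  have h : ContDiffOn ℝ m (fderiv ℝ u) Ω := hu.fderiv_of_isOpen hΩ (by norm_cast)
  exact h.clm_apply contDiffOn_const

theorem pd_congr {N : ℕ} {Ω : Set (EuclideanSpace ℝ (Fin N))} (hΩ : IsOpen Ω) (i : Fin N)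
    {u v : EuclideanSpace ℝ (Fin N) → ℝ} (h : Set.EqOn u v Ω) :
    Set.EqOn (pd i u) (pd i v) Ω := by
  intro x hx
  have : u =ᶠ[nhds x] v := Filter.eventuallyEq_of_mem (hΩ.mem_nhds hx) h
  simp only [pd, this.fderiv_eq]

theorem pd_comm {N : ℕ} {Ω : Set (EuclideanSpace ℝ (Fin N))} (hΩ : IsOpen Ω) (i j : Fin N)
    {u : EuclideanSpace ℝ (Fin N) → ℝ} (hu : ContDiffOn ℝ 2 u Ω) :
    Set.EqOn (pd i (pd j u)) (pd j (pd i u)) Ω := by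
  intro x hx
  have hat : ContDiffAt ℝ 2 u x := hu.contDiffAt (hΩ.mem_nhds hx)
  have hd : DifferentiableAt ℝ (fderiv ℝ u) x :=
    (hat.fderiv_right (m := 1) (by norm_num [one_add_one_eq_two])).differentiableAt (by norm_num)
  have key : ∀ a b : Fin N, pd a (pd b u) x =
      fderiv ℝ (fderiv ℝ u) x (EuclideanSpace.single a 1) (EuclideanSpace.single b 1) := by
    intro a b
    change fderiv ℝ (fun y => fderiv ℝ u y (EuclideanSpace.single b 1)) x _ = _
    rw [fderiv_clm_apply hd (differentiableAt_const _)]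
    simp
  rw [key, key]
  exact (hat.isSymmSndFDerivAt (by simp)).eq _ _

theorem pdIter_contDiffOn {N : ℕ} {Ω : Set (EuclideanSpace ℝ (Fin N))} (hΩ : IsOpen Ω)
    {u : EuclideanSpace ℝ (Fin N) → ℝ} (l : List (Fin N)) :
    ∀ m : ℕ, ContDiffOn ℝ ((m + l.length : ℕ)) u Ω → ContDiffOn ℝ m (pdIter l u) Ω := by
  induction l with
  | nil => intro m h; simpa [pdIter] using h
  | cons a l ih =>
    intro m h
    refine pd_contDiffOn hΩ a (ih (m + 1) ?_)
    have e : m + 1 + l.length = m + (a :: l).length := by simp; omega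
    rw [e]; exact h

theorem pdIter_perm {N : ℕ} {Ω : Set (EuclideanSpace ℝ (Fin N))} (hΩ : IsOpen Ω)
    {u : EuclideanSpace ℝ (Fin N) → ℝ} {l l' : List (Fin N)} (h : l.Perm l') :
    ContDiffOn ℝ (l.length : ℕ) u Ω → Set.EqOn (pdIter l u) (pdIter l' u) Ω := by
  induction h with
  | nil => intro _ x _; rfl
  | cons a _ ih =>
    intro hu
    exact pd_congr hΩ a (ih (hu.of_le (by simp)))
  | swap a b l =>
    intro hu
    refine pd_comm hΩ b a ?_
    refine pdIter_contDiffOn hΩ l 2 ?_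
    have e : 2 + l.length = (b :: a :: l).length := by simp; omega
    rw [e]; exact hu
  | trans h1 _ ih1 ih2 =>
    intro hu
    exact (ih1 hu).trans (ih2 (by rw [← h1.length_eq]; exact hu))

theorem sum_lists (M k : ℕ) : ∀ G : List (Fin (M + 1)) → ℝ,
    (∀ l l' : List (Fin (M + 1)), l.Perm l' → l.length = k → G l = G l') →
    ∑ i : Fin k → Fin (M + 1), G (List.ofFn i) =
      ∑ j ∈ Finset.range (k + 1), (Nat.choose k j : ℝ) *
        ∑ i' : Fin j → Fin M, G (List.ofFn (fun t => (i' t).castSucc) ++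
          List.replicate (k - j) (Fin.last M)) := by
  induction k with
  | zero => intro G _; simp
  | succ k ih =>
    intro G hG
    have hsum : ∀ (n m : ℕ) (F : (Fin (n + 1) → Fin m) → ℝ),
        ∑ i, F i = ∑ a : Fin m, ∑ r : Fin n → Fin m, F (Fin.cons a r) := by
      intro n m F
      rw [← Fintype.sum_prod_type']
      exact (Fintype.sum_equiv (Fin.consEquiv (fun _ => Fin m)) _ _ (fun _ => rfl)).symm
    rw [hsum]
    have hcons : ∀ a : Fin (M + 1), ∑ r : Fin k → Fin (M + 1),
        G (List.ofFn (Fin.cons a r : Fin (k + 1) → Fin (M + 1))) = ∑ j ∈ Finset.range (k + 1),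
          (Nat.choose k j : ℝ) * ∑ i' : Fin j → Fin M,
            G (a :: (List.ofFn (fun t => (i' t).castSucc) ++
              List.replicate (k - j) (Fin.last M))) := by
      intro a
      rw [← ih (fun l => G (a :: l)) (fun l l' h hl => hG _ _ (h.cons a) (by simp [hl]))]
      simp [List.ofFn_succ]
    simp only [hcons]
    rw [Fin.sum_univ_castSucc]
    rw [Finset.sum_choose_succ_mul (fun j m => ∑ i' : Fin j → Fin M,
      G (List.ofFn (fun t => (i' t).castSucc) ++ List.replicate m (Fin.last M))) k, add_comm]
    congr 1
    · refine Finset.sum_congr rfl fun j hj => ?_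
      have hj' : j ≤ k := by simpa [Nat.lt_succ_iff] using hj
      congr 1
      refine Finset.sum_congr rfl fun i' _ => ?_
      have e : k + 1 - j = (k - j) + 1 := by omega
      rw [e, List.replicate_succ]
      refine hG _ _ List.perm_middle.symm ?_
      simp; omega
    · rw [Finset.sum_comm]
      refine Finset.sum_congr rfl fun j hj => ?_
      rw [← Finset.mul_sum, hsum]
      simp [List.ofFn_succ]

theorem stmt_16 (N : ℕ) (hN : 2 ≤ N) (k : ℕ)
    (Ω : Set (EuclideanSpace ℝ (Fin N))) (hΩ : IsOpen Ω)
    (u : EuclideanSpace ℝ (Fin N) → ℝ) (hu : ContDiffOn ℝ k u Ω)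
    (x : EuclideanSpace ℝ (Fin N)) (hx : x ∈ Ω) :
    gradSq N k u x =
      ∑ j ∈ Finset.range (k + 1),
        (Nat.choose k j : ℝ) *
          ∑ i' : Fin j → Fin (N - 1),
            (pdIter (List.ofFn fun t => Fin.castLE (Nat.sub_le N 1) (i' t))
              (pdIter (List.replicate (k - j) (⟨N - 1, Nat.sub_lt (by omega) one_pos⟩ : Fin N)) u)
              x) ^ 2 := by
  obtain ⟨M, rfl⟩ : ∃ M, N = M + 1 := ⟨N - 1, by omega⟩
  have h := sum_lists M k (fun l => (pdIter l u x) ^ 2) (by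
    intro l l' hp hl
    have := pdIter_perm hΩ hp (by rw [hl]; exact hu) hx
    simp only [this])
  unfold gradSq
  rw [h]
  refine Finset.sum_congr rfl fun j _ => ?_
  congr 1
  refine Finset.sum_congr rfl fun i' _ => ?_
  simp only [pdIter, List.foldr_append]
  rfl
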